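/- arXiv:2508.21379 — 5 statements merged into one kernel-verified Lean document; each statement's English description precedes it below -/
import Mathlib

section
/- For every n ≥ 1, the number of consistent path systems on the vertex set [n] = {1,...,n} is at most n^{C(n,2)}, where C(n,2) = n(n−1)/2. -/
open SimpleGraph

/-- A path system on a simple graph `G`: for every pair of distinct vertices a chosen
simple path between them, with `P_{u,v} = P_{v,u}`. -/
structure PathSystem {V : Type*} (G : SimpleGraph V) where
  path : ∀ u v : V, u ≠ v → G.Path u v
  symm : ∀ (u v : V) (h : u ≠ v), (path v u (Ne.symm h)).val = (path u v h).val.reverse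

namespace PathSystem

variable {V : Type*} {G : SimpleGraph V}

/-- A path system is consistent if whenever `a` lies on `P_{u,v}`, the path `P_{u,v}` is
the concatenation of `P_{u,a}` and `P_{a,v}`. -/
def Consistent (P : PathSystem G) : Prop :=
  ∀ (u v : V) (huv : u ≠ v) (a : V) (hua : u ≠ a) (hav : a ≠ v),
    a ∈ (P.path u v huv).val.support →
      (P.path u v huv).val = (P.path u a hua).val.append (P.path a v hav).val

/-- A path system is neighborly if the chosen path between the endpoints of each edge is
that single edge. -/
def Neighborly (P : PathSystem G) : Prop :=
  ∀ (u v : V) (h : G.Adj u v),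
    (P.path u v h.ne).val = SimpleGraph.Walk.cons h SimpleGraph.Walk.nil

/-- The `w`-weight of a walk: the sum of the weights of its edges. -/
def wlen (w : Sym2 V → ℝ) {u v : V} (Q : G.Walk u v) : ℝ :=
  (Q.edges.map w).sum

/-- A path system is metric if for some positive edge weights every chosen path is a
shortest path between its endpoints. -/
def Metric (P : PathSystem G) : Prop :=
  ∃ w : Sym2 V → ℝ, (∀ e ∈ G.edgeSet, 0 < w e) ∧
    ∀ (u v : V) (h : u ≠ v) (Q : G.Path u v),
      wlen w (P.path u v h).val ≤ wlen w Q.val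

/-- A path system is strictly metric if for some positive edge weights every chosen path
is the unique shortest path between its endpoints. -/
def StrictlyMetric (P : PathSystem G) : Prop :=
  ∃ w : Sym2 V → ℝ, (∀ e ∈ G.edgeSet, 0 < w e) ∧
    ∀ (u v : V) (h : u ≠ v) (Q : G.Path u v), Q ≠ P.path u v h →
      wlen w (P.path u v h).val < wlen w Q.val

end PathSystem

namespace PathSystem

variable {V : Type*} {G : SimpleGraph V}

theorem length_pos (P : PathSystem G) {u v : V} (h : u ≠ v) :
    0 < (P.path u v h).val.length :=
  SimpleGraph.Walk.not_nil_iff_lt_length.mp (SimpleGraph.Walk.not_nil_of_ne h)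

theorem eq_swap_iff (P Q : PathSystem G) {u v : V} (h : u ≠ v) :
    (P.path u v h).val = (Q.path u v h).val ↔
      (P.path v u h.symm).val = (Q.path v u h.symm).val := by
  rw [P.symm u v h, Q.symm u v h, SimpleGraph.Walk.reverse_injective.eq_iff]

end PathSystem

/-- A path whose second vertex is its endpoint is a single edge. -/
theorem SimpleGraph.Walk.IsPath.eq_cons_nil_of_snd_eq {V : Type*} {G : SimpleGraph V} {u v : V}
    {p : G.Walk u v} (hp : p.IsPath) (huv : u ≠ v) (h : p.snd = v) :
    ∃ hadj : G.Adj u v, p = .cons hadj .nil := by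
  cases p with
  | nil => exact absurd rfl huv
  | cons hadj q =>
    rw [SimpleGraph.Walk.snd_cons] at h
    subst h
    obtain rfl := SimpleGraph.Walk.eq_nil_iff_nil.mpr
      (SimpleGraph.Walk.isPath_iff_nil.mp hp.of_cons)
    exact ⟨hadj, rfl⟩

namespace PathSystem

variable {V : Type*} {G : SimpleGraph V}

/-- A consistent path system is determined by the second vertices of its paths, where for
each pair of vertices either one of the two directions may be used. -/
theorem Consistent.eq_of_snd_eq {P Q : PathSystem G} (hP : P.Consistent) (hQ : Q.Consistent)
    (h : ∀ (u v : V) (huv : u ≠ v),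
      (P.path u v huv).val.snd = (Q.path u v huv).val.snd ∨
      (P.path v u huv.symm).val.snd = (Q.path v u huv.symm).val.snd) : P = Q := by
  have key : ∀ (k : ℕ) (u v : V) (huv : u ≠ v), (P.path u v huv).val.length = k →
      (P.path u v huv).val = (Q.path u v huv).val := by
    intro k
    induction k using Nat.strong_induction_on with
    | _ k ih =>
    have oriented : ∀ (u v : V) (huv : u ≠ v), (P.path u v huv).val.length = k →
        (P.path u v huv).val.snd = (Q.path u v huv).val.snd →
        (P.path u v huv).val = (Q.path u v huv).val := by
      intro u v huv hk hs
      have hua : u ≠ (P.path u v huv).val.snd :=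
        (SimpleGraph.Walk.adj_snd (SimpleGraph.Walk.not_nil_of_ne huv)).ne
      have haP : (P.path u v huv).val.snd ∈ (P.path u v huv).val.support :=
        SimpleGraph.Walk.getVert_mem_support _ _
      have haQ : (P.path u v huv).val.snd ∈ (Q.path u v huv).val.support :=
        hs ▸ SimpleGraph.Walk.getVert_mem_support _ _
      by_cases hav : (P.path u v huv).val.snd = v
      · obtain ⟨_, hp⟩ := (P.path u v huv).property.eq_cons_nil_of_snd_eq huv hav
        obtain ⟨_, hq⟩ := (Q.path u v huv).property.eq_cons_nil_of_snd_eq huv (hs ▸ hav)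
        rw [hp, hq]
      · generalize (P.path u v huv).val.snd = a at hua hav haP haQ
        have hPa := hP u v huv a hua hav haP
        have hlen := congrArg SimpleGraph.Walk.length hPa
        rw [SimpleGraph.Walk.length_append] at hlen
        have h₁ := P.length_pos hua
        have h₂ := P.length_pos hav
        rw [hPa, hQ u v huv a hua hav haQ, ih _ (by omega) u a hua rfl,
          ih _ (by omega) a v hav rfl]
    intro u v huv hk
    rcases h u v huv with hs | hs
    · exact oriented u v huv hk hs
    · refine (eq_swap_iff P Q huv).mpr (oriented v u huv.symm ?_ hs)
      rw [P.symm u v huv, SimpleGraph.Walk.length_reverse, hk]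
  have hpath : P.path = Q.path := by
    funext u v huv
    exact Subtype.ext (key _ u v huv rfl)
  cases P
  cases Q
  cases hpath
  rfl

theorem card_consistent_le [Fintype V] (G : SimpleGraph V) :
    Nat.card {P : PathSystem G // P.Consistent} ≤
      Fintype.card V ^ (Fintype.card V).choose 2 := by
  classical
  have hpair : ∀ e : {e : Sym2 V // ¬ e.IsDiag}, ∃ u v : V, u ≠ v ∧ e.val = s(u, v) := by
    rintro ⟨e, he⟩
    induction e with
    | _ u v => exact ⟨u, v, by simpa using he, rfl⟩
  choose s t hst hval using hpair
  let code : {P : PathSystem G // P.Consistent} → {e : Sym2 V // ¬ e.IsDiag} → V :=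
    fun P e => (P.val.path (s e) (t e) (hst e)).val.snd
  have hcode : Function.Injective code := by
    rintro ⟨P, hP⟩ ⟨Q, hQ⟩ hPQ
    refine Subtype.ext (hP.eq_of_snd_eq hQ fun u v huv => ?_)
    let e : {e : Sym2 V // ¬ e.IsDiag} := ⟨s(u, v), by simpa using huv⟩
    obtain ⟨a, b, hne, hends, hs⟩ : ∃ (a b : V) (hne : a ≠ b), s(u, v) = s(a, b) ∧
        (P.path a b hne).val.snd = (Q.path a b hne).val.snd :=
      ⟨s e, t e, hst e, hval e, congrFun hPQ e⟩
    rcases Sym2.eq_iff.mp hends with ⟨rfl, rfl⟩ | ⟨rfl, rfl⟩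
    · exact Or.inl hs
    · exact Or.inr hs
  refine (Nat.card_le_card_of_injective code hcode).trans_eq ?_
  rw [Nat.card_fun, Nat.card_eq_fintype_card, Nat.card_eq_fintype_card,
    Sym2.card_subtype_not_diag]

end PathSystem

theorem count_consistent_upper (n : ℕ) (hn : 1 ≤ n) :
    Nat.card {P : PathSystem (completeGraph (Fin n)) // P.Consistent} ≤
      n ^ (n * (n - 1) / 2) := by
  simpa [Nat.choose_two_right] using PathSystem.card_consistent_le (completeGraph (Fin n))
end

section
/- For every ε > 0 there exists N such that for all n ≥ N, the number of consistent metric path systems on the vertex set [n] is at least n^{(1−ε)n²/2}. -/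
open SimpleGraph

namespace PathSystem

variable {V : Type*}

open Classical in
/-- The path system on the complete graph in which two vertices `u, v` of `B` are joined
through the hub `hub s(u, v)` outside `B`, and all other pairs by their edge. -/
noncomputable def ofHub (B : Set V) (hub : Sym2 V → V) (hB : ∀ e, hub e ∉ B) :
    PathSystem (completeGraph V) where
  path u v h :=
    if hb : u ∈ B ∧ v ∈ B then
      ⟨.cons (show (completeGraph V).Adj u (hub s(u, v)) from
          fun h' => hB s(u, v) (h' ▸ hb.1))
        (.cons (show (completeGraph V).Adj (hub s(u, v)) v from
          fun h' => hB s(u, v) (h'.symm ▸ hb.2)) .nil), by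
        have h1 : u ≠ hub s(u, v) := fun h' => hB s(u, v) (h' ▸ hb.1)
        have h2 : hub s(u, v) ≠ v := fun h' => hB s(u, v) (h'.symm ▸ hb.2)
        simp [Walk.cons_isPath_iff, h, h1, h2]⟩
    else
      ⟨.cons (show (completeGraph V).Adj u v from h) .nil, by simp [Walk.cons_isPath_iff, h]⟩
  symm u v h := by
    by_cases hb : u ∈ B ∧ v ∈ B
    · have hvu : hub s(v, u) = hub s(u, v) := congrArg hub Sym2.eq_swap
      rw [dif_pos hb, dif_pos hb.symm]
      apply Walk.ext_support
      simp [hvu]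
    · rw [dif_neg hb, dif_neg fun h' => hb h'.symm]
      rfl

variable {B : Set V} {hub : Sym2 V → V} {hB : ∀ e, hub e ∉ B}

theorem support_ofHub_of_mem {u v : V} (h : u ≠ v) (hu : u ∈ B) (hv : v ∈ B) :
    ((ofHub B hub hB).path u v h).val.support = [u, hub s(u, v), v] := by
  simp [ofHub, hu, hv]

theorem support_ofHub_of_not_mem {u v : V} (h : u ≠ v) (hb : ¬(u ∈ B ∧ v ∈ B)) :
    ((ofHub B hub hB).path u v h).val.support = [u, v] := by
  simp only [ofHub, dif_neg hb]
  rfl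

theorem consistent_ofHub : (ofHub B hub hB).Consistent := by
  intro u v huv a hua hav ha
  by_cases hb : u ∈ B ∧ v ∈ B
  · rw [support_ofHub_of_mem huv hb.1 hb.2] at ha
    have ha' : a = hub s(u, v) := by simpa [hua.symm, hav] using ha
    have haB : a ∉ B := ha' ▸ hB _
    apply Walk.ext_support
    rw [Walk.support_append, support_ofHub_of_mem huv hb.1 hb.2,
      support_ofHub_of_not_mem hua fun h => haB h.2,
      support_ofHub_of_not_mem hav fun h => haB h.1, ha']
    rfl
  · rw [support_ofHub_of_not_mem huv hb] at ha
    simp [hua.symm, hav] at ha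

theorem length_le_wlen {G : SimpleGraph V} {w : Sym2 V → ℝ} (hw : ∀ e, 1 ≤ w e) {u v : V}
    (Q : G.Walk u v) : (Q.length : ℝ) ≤ wlen w Q := by
  induction Q with
  | nil => simp [wlen]
  | @cons x y _ h p ih =>
    simp only [wlen, Walk.length_cons, Walk.edges_cons, List.map_cons, List.sum_cons,
      Nat.cast_add, Nat.cast_one] at ih ⊢
    linarith [hw s(x, y)]

open Classical in
theorem metric_ofHub : (ofHub B hub hB).Metric := by
  set w : Sym2 V → ℝ := fun e => if ∀ x ∈ e, x ∈ B then 2 else 1 with hw_def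
  have hw (e : Sym2 V) : 1 ≤ w e := by
    simp only [hw_def]; split_ifs <;> norm_num
  have hw_mk (u v : V) : w s(u, v) = if u ∈ B ∧ v ∈ B then 2 else 1 := by
    simp [hw_def]
  refine ⟨w, fun e _ => zero_lt_one.trans_le (hw e), fun u v huv Q => ?_⟩
  obtain ⟨Q, -⟩ := Q
  have hQ := length_le_wlen hw Q
  by_cases hb : u ∈ B ∧ v ∈ B
  · have hP : wlen w ((ofHub B hub hB).path u v huv).val = 2 := by
      simp only [ofHub, dif_pos hb, wlen]
      simp [hw_mk, hB]
      norm_num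
    rw [hP]
    cases Q with
    | nil => exact absurd rfl huv
    | cons h p =>
      cases p with
      | nil => simp [wlen, hw_mk, hb]
      | cons h' p =>
        refine le_trans ?_ hQ
        simp only [Walk.length_cons]
        push_cast
        linarith [(Nat.cast_nonneg p.length : (0 : ℝ) ≤ p.length)]
  · have hP : wlen w ((ofHub B hub hB).path u v huv).val = 1 := by
      simp only [ofHub, dif_neg hb, wlen]
      simp [hw_mk, hb]
    rw [hP]
    cases Q with
    | nil => exact absurd rfl huv
    | cons h p =>
      refine le_trans ?_ hQ
      simp

theorem hub_eq_of_ofHub_eq {hub' : Sym2 V → V} {hB' : ∀ e, hub' e ∉ B}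
    (h : ofHub B hub hB = ofHub B hub' hB') {u v : V} (huv : u ≠ v) (hu : u ∈ B) (hv : v ∈ B) :
    hub s(u, v) = hub' s(u, v) := by
  have hs := support_ofHub_of_mem (hB := hB) huv hu hv
  rw [h, support_ofHub_of_mem huv hu hv] at hs
  simpa using hs.symm

instance [Finite V] (G : SimpleGraph V) : Finite (PathSystem G) := by
  classical
  have := Fintype.ofFinite V
  have := Classical.decRel G.Adj
  refine Finite.of_injective (fun P : PathSystem G => P.path) fun P Q h => ?_
  cases P
  cases Q
  congr

end PathSystem

theorem pow_choose_two_le_card_metric {m k : ℕ} (hm : 0 < m) :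
    m ^ k.choose 2 ≤ Nat.card {P : PathSystem (completeGraph (Fin (m + k))) //
      P.Consistent ∧ P.Metric} := by
  set B : Set (Fin (m + k)) := Set.range (Fin.natAdd m)
  set pair : {e : Sym2 (Fin k) // ¬e.IsDiag} → Sym2 (Fin (m + k)) :=
    fun e => Sym2.map (Fin.natAdd m) e.1
  have pair_inj : pair.Injective :=
    (Sym2.map.injective (Fin.natAdd_injective k m)).comp Subtype.val_injective
  have castAdd_notMem (i : Fin m) : Fin.castAdd k i ∉ B := by
    rintro ⟨j, hj⟩
    have := congrArg Fin.val hj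
    simp at this
    omega
  set hub : ({e : Sym2 (Fin k) // ¬e.IsDiag} → Fin m) → Sym2 (Fin (m + k)) → Fin (m + k) :=
    fun g e => Fin.castAdd k (Function.extend pair g (fun _ => ⟨0, hm⟩) e) with hub_def
  have hub_notMem (g) (e) : hub g e ∉ B := castAdd_notMem _
  have hcard : Nat.card ({e : Sym2 (Fin k) // ¬e.IsDiag} → Fin m) = m ^ k.choose 2 := by
    rw [Nat.card_eq_fintype_card, Fintype.card_fun, Fintype.card_fin,
      Sym2.card_subtype_not_diag, Fintype.card_fin]
  rw [← hcard]
  refine Nat.card_le_card_of_injective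
    (fun g => ⟨PathSystem.ofHub B (hub g) (hub_notMem g),
      PathSystem.consistent_ofHub, PathSystem.metric_ofHub⟩) fun g g' h => ?_
  funext ⟨e, he⟩
  have hext : hub g (pair ⟨e, he⟩) = hub g' (pair ⟨e, he⟩) := by
    induction e with | _ i j
    exact PathSystem.hub_eq_of_ofHub_eq (hB := hub_notMem g) (hB' := hub_notMem g')
      (congrArg Subtype.val h)
      (fun hij => he (Fin.natAdd_injective k m hij)) ⟨i, rfl⟩ ⟨j, rfl⟩
  simpa only [hub_def, pair_inj.extend_apply, Fin.castAdd_inj] using hext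

theorem exists_rpow_le_pow_choose_two {ε : ℝ} (hε : 0 < ε) (hε1 : ε ≤ 1) :
    ∃ N : ℕ, ∀ n : ℕ, N ≤ n → ∃ m k : ℕ, 0 < m ∧ m + k = n ∧
      (n : ℝ) ^ ((1 - ε) * (n : ℝ) ^ 2 / 2) ≤ (m : ℝ) ^ k.choose 2 := by
  set η := ε / 5 with hη
  have hη0 : 0 < η := by positivity
  have hη1 : η ≤ 1 / 5 := by linarith
  have hlim : Filter.Tendsto (fun n : ℕ => (n : ℝ) ^ η) Filter.atTop Filter.atTop :=
    (tendsto_rpow_atTop hη0).comp tendsto_natCast_atTop_atTop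
  have hev := (hlim.eventually_ge_atTop (1 / η)).and
    (tendsto_natCast_atTop_atTop.eventually_ge_atTop (2 / η : ℝ))
  obtain ⟨N, hN⟩ := Filter.eventually_atTop.1 hev
  refine ⟨N, fun n hn => ?_⟩
  obtain ⟨h1, h2⟩ := hN n hn
  rw [div_le_iff₀ hη0] at h1 h2
  have hn0 : (0 : ℝ) < n := by nlinarith
  have hn1 : (1 : ℝ) ≤ n := by nlinarith
  obtain ⟨k, hk⟩ : ∃ k, n = ⌈η * n⌉₊ + k :=
    Nat.exists_eq_add_of_le (Nat.ceil_le.2 (by nlinarith))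
  set m := ⌈η * n⌉₊
  have hm_lt : (m : ℝ) < η * n + 1 := Nat.ceil_lt_add_one (by positivity)
  have hm_le : η * n ≤ m := Nat.le_ceil _
  have hk' : (k : ℝ) = n - m := by
    rw [eq_sub_iff_add_eq']; exact_mod_cast hk.symm
  refine ⟨m, k, Nat.ceil_pos.2 (by positivity), hk.symm, ?_⟩
  have hm_rpow : (n : ℝ) ^ (1 - η) ≤ m := by
    refine le_trans ?_ hm_le
    rw [Real.rpow_sub hn0, Real.rpow_one, div_le_iff₀ (by positivity)]
    nlinarith
  have hk1 : (1 - 2 * η) * n ≤ k - 1 := by nlinarith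
  have hprod : ((1 - 2 * η) * n) * ((1 - 2 * η) * n) ≤ (k : ℝ) * (k - 1) := by
    have : 0 ≤ (1 - 2 * η) * n := by
      apply mul_nonneg _ hn0.le; linarith
    apply mul_le_mul _ hk1 this <;> linarith
  calc (n : ℝ) ^ ((1 - ε) * (n : ℝ) ^ 2 / 2)
      ≤ (n : ℝ) ^ ((1 - η) * (k.choose 2 : ℕ)) := by
        apply Real.rpow_le_rpow_of_exponent_le hn1
        rw [Nat.cast_choose_two]
        have h3 : (1 - ε) ≤ (1 - η) * ((1 - 2 * η) * (1 - 2 * η)) := by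
          have : ε = 5 * η := by rw [hη]; ring
          rw [this]
          nlinarith [mul_nonneg hη0.le hη0.le,
            mul_nonneg (mul_nonneg hη0.le hη0.le) (sub_nonneg.2 hη1)]
        have h4 := mul_le_mul_of_nonneg_right h3 (sq_nonneg (n : ℝ))
        have h5 := mul_le_mul_of_nonneg_left hprod (by linarith : 0 ≤ 1 - η)
        linarith
    _ = ((n : ℝ) ^ (1 - η)) ^ k.choose 2 := by
        rw [Real.rpow_mul hn0.le, Real.rpow_natCast]
    _ ≤ (m : ℝ) ^ k.choose 2 := by gcongr

theorem count_metric_lower :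
    ∀ ε : ℝ, 0 < ε → ∃ N : ℕ, ∀ n : ℕ, N ≤ n →
      (n : ℝ) ^ ((1 - ε) * (n : ℝ) ^ 2 / 2) ≤
        (Nat.card {P : PathSystem (completeGraph (Fin n)) //
          P.Consistent ∧ P.Metric} : ℝ) := by
  intro ε hε
  obtain ⟨N, hN⟩ := exists_rpow_le_pow_choose_two (lt_min hε one_pos) (min_le_right ε 1)
  refine ⟨max N 1, fun n hn => ?_⟩
  obtain ⟨m, k, hm, rfl, hmk⟩ := hN n (le_of_max_le_left hn)
  have hn1 : (1 : ℝ) ≤ ((m + k : ℕ) : ℝ) := by exact_mod_cast le_of_max_le_right hn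
  calc (((m + k : ℕ) : ℝ)) ^ ((1 - ε) * ((m + k : ℕ) : ℝ) ^ 2 / 2)
      ≤ ((m + k : ℕ) : ℝ) ^ ((1 - min ε 1) * ((m + k : ℕ) : ℝ) ^ 2 / 2) := by
        apply Real.rpow_le_rpow_of_exponent_le hn1
        gcongr
        exact min_le_left ε 1
    _ ≤ (m : ℝ) ^ k.choose 2 := hmk
    _ ≤ _ := by exact_mod_cast pow_choose_two_le_card_metric hm
end

section
/- If P and Q are consistent path systems on the vertex set [n] and some partial function f from unordered pairs of [n] to [n] is simultaneously a résumé of P and a résumé of Q, then P = Q. In other words, a résumé uniquely determines its consistent path system. -/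
open SimpleGraph

/-- `f` is a résumé of the path system `P` on `[n]`: a partial function on unordered
pairs (encoded with `Option`), defined exactly on the pairs `{u,v}` whose path is not the
single edge `uv`, assigning to such a pair an internal vertex of `P_{u,v}`. -/
def IsResume {n : ℕ} (P : PathSystem (completeGraph (Fin n)))
    (f : Sym2 (Fin n) → Option (Fin n)) : Prop :=
  (∀ u : Fin n, f s(u, u) = none) ∧
  ∀ (u v : Fin n) (h : u ≠ v),
    (f s(u, v) = none ↔ (P.path u v h).val.length = 1) ∧
    ∀ c : Fin n, f s(u, v) = some c →
      c ∈ (P.path u v h).val.support ∧ c ≠ u ∧ c ≠ v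

theorem SimpleGraph.Walk.eq_of_length_eq_one {V : Type*} {G : SimpleGraph V} {u v : V}
    {p q : G.Walk u v} (hp : p.length = 1) (hq : q.length = 1) : p = q := by
  match p, q with
  | .cons _ .nil, .cons _ .nil => rfl
  | .nil, _ => simp at hp
  | _, .nil => simp at hq
  | .cons _ (.cons _ _), _ => simp at hp
  | _, .cons _ (.cons _ _) => simp at hq

theorem SimpleGraph.Walk.length_pos_of_ne {V : Type*} {G : SimpleGraph V} {u v : V}
    (p : G.Walk u v) (h : u ≠ v) : 0 < p.length :=
  Nat.pos_of_ne_zero fun h0 => h (p.eq_of_length_eq_zero h0)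

theorem IsResume.path_val_eq {n : ℕ} {P Q : PathSystem (completeGraph (Fin n))}
    (hP : P.Consistent) (hQ : Q.Consistent) {f : Sym2 (Fin n) → Option (Fin n)}
    (hfP : IsResume P f) (hfQ : IsResume Q f) (u v : Fin n) (h : u ≠ v) :
    (P.path u v h).val = (Q.path u v h).val := by
  induction hk : (P.path u v h).val.length using Nat.strong_induction_on generalizing u v with
  | _ k ih =>
    cases hc : f s(u, v) with
    | none =>
      exact Walk.eq_of_length_eq_one (((hfP.2 u v h).1).1 hc) (((hfQ.2 u v h).1).1 hc)
    | some c =>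
      obtain ⟨hcP, hcu, hcv⟩ := (hfP.2 u v h).2 c hc
      have hcQ := ((hfQ.2 u v h).2 c hc).1
      have hPsplit := hP u v h c hcu.symm hcv hcP
      have hlen := congrArg Walk.length hPsplit
      rw [Walk.length_append, hk] at hlen
      have hleft := (P.path u c hcu.symm).val.length_pos_of_ne hcu.symm
      have hright := (P.path c v hcv).val.length_pos_of_ne hcv
      rw [hPsplit, hQ u v h c hcu.symm hcv hcQ,
        ih _ (by omega) u c hcu.symm rfl, ih _ (by omega) c v hcv rfl]

theorem resume_determines_system (n : ℕ)
    (P Q : PathSystem (completeGraph (Fin n)))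
    (hP : P.Consistent) (hQ : Q.Consistent)
    (f : Sym2 (Fin n) → Option (Fin n))
    (hfP : IsResume P f) (hfQ : IsResume Q f) :
    P = Q := by
  have hpath : P.path = Q.path := by
    funext u v h
    exact Subtype.ext (hfP.path_val_eq hP hQ hfQ u v h)
  cases P
  cases Q
  cases hpath
  rfl
end

section
/- A consistent path system P on the vertex set [n] is strictly metric if and only if there exists a metric ρ on [n] such that T(P) = T(ρ). -/
open SimpleGraph

/-- A pointed triple `{a,b;c}` on `[n]`: an unordered pair `{a,b}` of distinct vertices
together with a distinguished third vertex `c ∉ {a,b}`. -/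
abbrev PointedTriple (n : ℕ) :=
  {p : Sym2 (Fin n) × Fin n // ¬ p.1.IsDiag ∧ p.2 ∉ p.1}

/-- `ρ` is a pseudometric on `Fin n`. -/
def IsPseudometric {n : ℕ} (ρ : Fin n → Fin n → ℝ) : Prop :=
  (∀ x, ρ x x = 0) ∧ (∀ x y, ρ x y = ρ y x) ∧ ∀ x y z, ρ x z ≤ ρ x y + ρ y z

/-- `ρ` is a metric on `Fin n`. -/
def IsMetric {n : ℕ} (ρ : Fin n → Fin n → ℝ) : Prop :=
  IsPseudometric ρ ∧ ∀ x y : Fin n, x ≠ y → 0 < ρ x y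

/-- `T(ρ)`: the set of pointed triples `{a,b;c}` that are colinear w.r.t. `ρ`, i.e.
`ρ(a,b) = ρ(a,c) + ρ(c,b)`. -/
def Tpm {n : ℕ} (ρ : Fin n → Fin n → ℝ) : Set (PointedTriple n) :=
  {t | ∃ a b : Fin n, t.val.1 = s(a, b) ∧ ρ a b = ρ a t.val.2 + ρ t.val.2 b}

/-- `T(P)`: the set of pointed triples `{a,b;c}` with `c` a vertex of the path `P_{a,b}`. -/
def Tsys {n : ℕ} (P : PathSystem (completeGraph (Fin n))) : Set (PointedTriple n) :=
  {t | ∃ (a b : Fin n) (h : a ≠ b),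
    t.val.1 = s(a, b) ∧ t.val.2 ∈ (P.path a b h).val.support}

namespace List

theorem Sublist.eq_or_sum_map_lt {α : Type*} {w : α → ℝ} {l₁ l₂ : List α} (h : l₁.Sublist l₂)
    (hw : ∀ e ∈ l₂, 0 < w e) : l₁ = l₂ ∨ (l₁.map w).sum < (l₂.map w).sum := by
  induction h with
  | slnil => simp
  | cons a _ ih =>
    right
    have ha := hw a (by simp)
    rcases ih (fun e he => hw e (by simp [he])) with rfl | h
    · simpa using ha
    · simp only [map_cons, sum_cons]
      linarith
  | cons_cons a _ ih =>
    rcases ih (fun e he => hw e (by simp [he])) with rfl | h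
    · simp
    · right
      simpa using h

end List

namespace PathSystem

variable {V : Type*} {G : SimpleGraph V}

@[simp]
theorem wlen_nil (w : Sym2 V → ℝ) (u : V) : wlen w (Walk.nil : G.Walk u u) = 0 := by
  simp [wlen]

@[simp]
theorem wlen_cons (w : Sym2 V → ℝ) {u v x : V} (h : G.Adj u x) (p : G.Walk x v) :
    wlen w (Walk.cons h p) = w s(u, x) + wlen w p := by
  simp [wlen]

theorem wlen_append (w : Sym2 V → ℝ) {u v x : V} (p : G.Walk u x) (q : G.Walk x v) :
    wlen w (p.append q) = wlen w p + wlen w q := by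
  simp [wlen]

theorem wlen_reverse (w : Sym2 V → ℝ) {u v : V} (p : G.Walk u v) :
    wlen w p.reverse = wlen w p := by
  simp [wlen, List.sum_reverse]

theorem wlen_pos {w : Sym2 V → ℝ} (hw : ∀ e ∈ G.edgeSet, 0 < w e) {u v : V} (h : u ≠ v)
    (p : G.Walk u v) : 0 < wlen w p := by
  rcases (List.nil_sublist p.edges).eq_or_sum_map_lt
    (fun e he => hw e (p.edges_subset_edgeSet he)) with h0 | h0
  · cases p <;> simp_all
  · simpa [wlen] using h0

theorem wlen_bypass_le [DecidableEq V] {w : Sym2 V → ℝ} (hw : ∀ e ∈ G.edgeSet, 0 < w e)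
    {u v : V} (p : G.Walk u v) : wlen w p.bypass ≤ wlen w p := by
  rcases p.edges_bypass_sublist_edges.eq_or_sum_map_lt
    (fun e he => hw e (p.edges_subset_edgeSet he)) with h | h
  · simp [wlen, h]
  · exact h.le

/-- Under weights witnessing strict metricity, a walk no heavier than the chosen path only visits
vertices of the chosen path. -/
theorem mem_support_of_wlen_le (P : PathSystem G) {w : Sym2 V → ℝ}
    (hw : ∀ e ∈ G.edgeSet, 0 < w e)
    (hP : ∀ (u v : V) (h : u ≠ v) (Q : G.Path u v), Q ≠ P.path u v h →
      wlen w (P.path u v h).val < wlen w Q.val) {u v : V} (h : u ≠ v) (p : G.Walk u v)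
    (hp : wlen w p ≤ wlen w (P.path u v h).val) {c : V} (hc : c ∈ p.support) :
    c ∈ (P.path u v h).val.support := by
  classical
  have hlt := p.edges_bypass_sublist_edges.eq_or_sum_map_lt
    (fun e he => hw e (p.edges_subset_edgeSet he))
  have hle := wlen_bypass_le hw p
  have hb : (⟨p.bypass, p.bypass_isPath⟩ : G.Path u v) = P.path u v h := by
    by_contra hne
    have := hP u v h _ hne
    simp only at this
    linarith
  have hedges : p.bypass.edges = p.edges := by
    rcases hlt with h' | h'
    · exact h'
    · rw [← hb] at hp
      exact absurd hp (not_le.mpr h')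
  have hself : p.bypass = p := by
    apply p.bypass_eq_self_of_length_le_length_bypass
    rw [← Walk.length_edges p, ← Walk.length_edges p.bypass, hedges]
  rw [← hb]
  simpa [hself] using hc

/-- Under weights witnessing strict metricity, the chosen path is no heavier than any walk. -/
theorem wlen_path_le (P : PathSystem G) {w : Sym2 V → ℝ} (hw : ∀ e ∈ G.edgeSet, 0 < w e)
    (hP : ∀ (u v : V) (h : u ≠ v) (Q : G.Path u v), Q ≠ P.path u v h →
      wlen w (P.path u v h).val < wlen w Q.val) {u v : V} (h : u ≠ v) (p : G.Walk u v) :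
    wlen w (P.path u v h).val ≤ wlen w p := by
  classical
  have hle := wlen_bypass_le hw p
  by_cases hne : (⟨p.bypass, p.bypass_isPath⟩ : G.Path u v) = P.path u v h
  · rw [← hne]
    exact hle
  · exact (hP u v h _ hne).le.trans hle

open Classical in
/-- The distance between two vertices along the chosen path. -/
noncomputable def pathDist (P : PathSystem G) (w : Sym2 V → ℝ) (u v : V) : ℝ :=
  if h : u = v then 0 else wlen w (P.path u v h).val

@[simp]
theorem pathDist_self (P : PathSystem G) (w : Sym2 V → ℝ) (u : V) : P.pathDist w u u = 0 := by
  simp [pathDist]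

theorem pathDist_of_ne (P : PathSystem G) (w : Sym2 V → ℝ) {u v : V} (h : u ≠ v) :
    P.pathDist w u v = wlen w (P.path u v h).val := by
  simp [pathDist, h]

theorem pathDist_comm (P : PathSystem G) (w : Sym2 V → ℝ) (u v : V) :
    P.pathDist w u v = P.pathDist w v u := by
  by_cases h : u = v
  · rw [h]
  · rw [pathDist_of_ne P w h, pathDist_of_ne P w (Ne.symm h), P.symm u v h, wlen_reverse]

open Classical in
/-- Edge weights which agree with `ρ` on the edges chosen by `P`, and exceed it by one on all
other pairs. -/
noncomputable def metricWeight (P : PathSystem G) {ρ : V → V → ℝ} (hρ : ∀ x y, ρ x y = ρ y x) :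
    Sym2 V → ℝ :=
  Sym2.lift ⟨fun a b => ρ a b + if ∃ h : a ≠ b, (P.path a b h).val.length = 1 then 0 else 1, by
    intro a b
    have key : ∀ a b : V, (∃ h : a ≠ b, (P.path a b h).val.length = 1) →
        ∃ h : b ≠ a, (P.path b a h).val.length = 1 := by
      rintro a b ⟨h, hl⟩
      exact ⟨h.symm, by rw [P.symm a b h, Walk.length_reverse, hl]⟩
    dsimp only
    rw [hρ a b, if_congr ⟨key a b, key b a⟩ rfl rfl]⟩

open Classical in
theorem metricWeight_mk (P : PathSystem G) {ρ : V → V → ℝ} (hρ : ∀ x y, ρ x y = ρ y x)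
    (a b : V) : P.metricWeight hρ s(a, b) =
      ρ a b + if ∃ h : a ≠ b, (P.path a b h).val.length = 1 then 0 else 1 := rfl

theorem le_metricWeight (P : PathSystem G) {ρ : V → V → ℝ} (hρ : ∀ x y, ρ x y = ρ y x)
    (a b : V) : ρ a b ≤ P.metricWeight hρ s(a, b) := by
  rw [metricWeight_mk]
  split_ifs <;> linarith

theorem length_eq_one_of_metricWeight_le (P : PathSystem G) {ρ : V → V → ℝ}
    (hρ : ∀ x y, ρ x y = ρ y x) {a b : V} (h : a ≠ b)
    (hle : P.metricWeight hρ s(a, b) ≤ ρ a b) : (P.path a b h).val.length = 1 := by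
  rw [metricWeight_mk] at hle
  split_ifs at hle with h1
  · exact h1.2
  · linarith

/-- The metric weight of the chosen path is the distance, provided `ρ` is additive at the vertices
of chosen paths. -/
theorem wlen_metricWeight_path (P : PathSystem G) (hP : P.Consistent) {ρ : V → V → ℝ}
    (hρ : ∀ x y, ρ x y = ρ y x)
    (hadd : ∀ (a b c : V) (h : a ≠ b), c ≠ a → c ≠ b → c ∈ (P.path a b h).val.support →
      ρ a b = ρ a c + ρ c b) {u v : V} (h : u ≠ v) :
    wlen (P.metricWeight hρ) (P.path u v h).val = ρ u v := by
  induction hk : (P.path u v h).val.length using Nat.strong_induction_on generalizing u v with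
  | _ k ih =>
    by_cases h1 : (P.path u v h).val.length = 1
    · have hw : P.metricWeight hρ s(u, v) = ρ u v := by
        rw [metricWeight_mk, if_pos ⟨h, h1⟩, add_zero]
      generalize (P.path u v h).val = p at h1
      match p, h1 with
      | .cons _ .nil, _ => simp [hw]
    · obtain ⟨x, hxu, hxv, hx⟩ : ∃ x, x ≠ u ∧ x ≠ v ∧ x ∈ (P.path u v h).val.support := by
        have hpath := (P.path u v h).property
        generalize (P.path u v h).val = p at h1 hpath
        match p, h1, hpath with
        | .nil, _, _ => exact absurd rfl h
        | .cons (v := x) hux q, h1, hpath =>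
          refine ⟨x, hux.ne.symm, ?_, by simp⟩
          rintro rfl
          have := hpath.of_cons
          rw [Walk.isPath_iff_nil, ← Walk.eq_nil_iff_nil] at this
          simp [this] at h1
      have happ := hP u v h x hxu.symm hxv hx
      have hlen := congrArg Walk.length happ
      rw [Walk.length_append] at hlen
      have pos : ∀ (a b : V) (hab : a ≠ b), 0 < (P.path a b hab).val.length := fun a b hab =>
        Nat.pos_of_ne_zero fun h0 => hab (Walk.eq_of_length_eq_zero h0)
      have p1 := pos u x hxu.symm
      have p2 := pos x v hxv
      rw [happ, wlen_append, ih _ (by omega) hxu.symm rfl, ih _ (by omega) hxv rfl,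
        hadd u v x h hxu hxv hx]

theorem le_wlen_metricWeight (P : PathSystem G) {ρ : V → V → ℝ} (hzero : ∀ x, ρ x x = 0)
    (hρ : ∀ x y, ρ x y = ρ y x) (htri : ∀ x y z, ρ x z ≤ ρ x y + ρ y z) {u v : V}
    (p : G.Walk u v) : ρ u v ≤ wlen (P.metricWeight hρ) p := by
  induction p with
  | nil => simp [hzero]
  | @cons a b c hab q ih =>
    have := P.le_metricWeight hρ a b
    have := htri a b c
    rw [wlen_cons]
    linarith

theorem eq_cons_of_length_eq_one {u v : V} (h : G.Adj u v) (p : G.Walk u v)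
    (hp : p.length = 1) : p = Walk.cons h Walk.nil := by
  match p, hp with
  | .cons _ .nil, _ => rfl

/-- The chosen path is the only path whose metric weight attains the distance. -/
theorem eq_path_of_wlen_metricWeight_le (P : PathSystem G) (hP : P.Consistent) {ρ : V → V → ℝ}
    (hzero : ∀ x, ρ x x = 0) (hρ : ∀ x y, ρ x y = ρ y x)
    (htri : ∀ x y z, ρ x z ≤ ρ x y + ρ y z)
    (hmem : ∀ (a b c : V) (h : a ≠ b), c ≠ a → c ≠ b → ρ a b = ρ a c + ρ c b →
      c ∈ (P.path a b h).val.support) {u v : V} (h : u ≠ v) (p : G.Walk u v) (hp : p.IsPath)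
    (hle : wlen (P.metricWeight hρ) p ≤ ρ u v) : p = (P.path u v h).val := by
  induction p with
  | nil => exact absurd rfl h
  | @cons a b c hab q ih =>
    rw [wlen_cons] at hle
    have h1 := P.le_metricWeight hρ a b
    have h2 := P.le_wlen_metricWeight hzero hρ htri q
    have h3 := htri a b c
    have hone : (P.path a b hab.ne).val.length = 1 :=
      P.length_eq_one_of_metricWeight_le hρ hab.ne (by linarith)
    by_cases hbc : b = c
    · subst hbc
      rw [Walk.eq_nil_iff_nil.mpr (Walk.isPath_iff_nil.mp hp.of_cons)]
      exact (eq_cons_of_length_eq_one hab _ hone).symm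
    · have hb := hmem a c b h hab.ne.symm hbc (by linarith)
      rw [hP a c h b hab.ne hbc hb, eq_cons_of_length_eq_one hab _ hone,
        ih hbc hp.of_cons (by linarith)]
      rfl

end PathSystem

theorem mk_mem_Tpm {n : ℕ} {ρ : Fin n → Fin n → ℝ} (hρ : ∀ x y, ρ x y = ρ y x)
    {a b c : Fin n} (ht : ¬ s(a, b).IsDiag ∧ c ∉ s(a, b)) :
    (⟨(s(a, b), c), ht⟩ : PointedTriple n) ∈ Tpm ρ ↔ ρ a b = ρ a c + ρ c b := by
  constructor
  · rintro ⟨a', b', hs, h⟩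
    simp only at hs h
    rcases Sym2.eq_iff.mp hs with ⟨rfl, rfl⟩ | ⟨rfl, rfl⟩
    · exact h
    · rw [hρ a b, hρ a c, hρ c b, h, add_comm]
  · exact fun h => ⟨a, b, rfl, h⟩

theorem mk_mem_Tsys {n : ℕ} (P : PathSystem (completeGraph (Fin n)))
    {a b c : Fin n} (h : a ≠ b) (ht : ¬ s(a, b).IsDiag ∧ c ∉ s(a, b)) :
    (⟨(s(a, b), c), ht⟩ : PointedTriple n) ∈ Tsys P ↔ c ∈ (P.path a b h).val.support := by
  constructor
  · rintro ⟨a', b', h', hs, hc⟩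
    simp only at hs hc
    rcases Sym2.eq_iff.mp hs with ⟨rfl, rfl⟩ | ⟨rfl, rfl⟩
    · exact hc
    · rw [P.symm a b h, Walk.support_reverse] at hc
      exact List.mem_reverse.mp hc
  · exact fun hc => ⟨a, b, h, rfl, hc⟩

theorem Tsys_eq_Tpm_iff {n : ℕ} (P : PathSystem (completeGraph (Fin n)))
    {ρ : Fin n → Fin n → ℝ} (hρ : ∀ x y, ρ x y = ρ y x) :
    Tsys P = Tpm ρ ↔ ∀ (a b c : Fin n) (h : a ≠ b), c ≠ a → c ≠ b →
      (c ∈ (P.path a b h).val.support ↔ ρ a b = ρ a c + ρ c b) := by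
  constructor
  · intro hT a b c h hca hcb
    have ht : ¬ s(a, b).IsDiag ∧ c ∉ s(a, b) := by simp [h, hca, hcb]
    rw [← mk_mem_Tsys P h ht, ← mk_mem_Tpm hρ ht, hT]
  · intro H
    ext ⟨⟨e, c⟩, ht⟩
    induction e with
    | _ a b =>
      have ht' := ht
      simp only [Sym2.mk_isDiag_iff, Sym2.mem_iff, not_or] at ht'
      rw [mk_mem_Tsys P ht'.1 ht, mk_mem_Tpm hρ ht]
      exact H a b c ht'.1 ht'.2.1 ht'.2.2

theorem strictly_metric_iff_metric_triples (n : ℕ)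
    (P : PathSystem (completeGraph (Fin n))) (hP : P.Consistent) :
    P.StrictlyMetric ↔ ∃ ρ : Fin n → Fin n → ℝ, IsMetric ρ ∧ Tsys P = Tpm ρ := by
  constructor
  · rintro ⟨w, hw, hmin⟩
    have hsymm := P.pathDist_comm w
    have hpos : ∀ x y, x ≠ y → 0 < P.pathDist w x y := fun x y h => by
      rw [P.pathDist_of_ne w h]
      exact PathSystem.wlen_pos hw h _
    refine ⟨P.pathDist w, ⟨⟨P.pathDist_self w, hsymm, ?_⟩, hpos⟩, ?_⟩
    · intro x y z
      by_cases hxy : x = y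
      · simp [hxy]
      by_cases hyz : y = z
      · simp [hyz]
      by_cases hxz : x = z
      · subst hxz
        rw [P.pathDist_self]
        exact (add_pos (hpos _ _ hxy) (hpos _ _ hyz)).le
      rw [P.pathDist_of_ne w hxy, P.pathDist_of_ne w hyz, P.pathDist_of_ne w hxz,
        ← PathSystem.wlen_append]
      exact P.wlen_path_le hw hmin hxz _
    · rw [Tsys_eq_Tpm_iff P hsymm]
      intro a b c h hca hcb
      rw [P.pathDist_of_ne w h, P.pathDist_of_ne w hca.symm, P.pathDist_of_ne w hcb,
        ← PathSystem.wlen_append]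
      constructor
      · intro hc
        rw [hP a b h c hca.symm hcb hc]
      · intro heq
        refine P.mem_support_of_wlen_le hw hmin h _ heq.ge ?_
        simp [Walk.mem_support_append_iff]
  · rintro ⟨ρ, ⟨⟨hzero, hsymm, htri⟩, hpos⟩, hT⟩
    rw [Tsys_eq_Tpm_iff P hsymm] at hT
    refine ⟨P.metricWeight hsymm, ?_, ?_⟩
    · intro e he
      induction e with
      | _ a b =>
        have hab := (mem_edgeSet _).mp he
        exact (hpos a b hab.ne).trans_le (P.le_metricWeight hsymm a b)
    · intro u v h Q hne
      rw [P.wlen_metricWeight_path hP hsymm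
        (fun a b c hab hca hcb hc => (hT a b c hab hca hcb).mp hc) h]
      by_contra! hle
      exact hne (Subtype.ext (P.eq_path_of_wlen_metricWeight_le hP hzero hsymm htri
        (fun a b c hab hca hcb hc => (hT a b c hab hca hcb).mpr hc) h Q.val Q.property hle))
end

section
/- Let S be a set of pointed triples on [n]. There is no pseudometric ρ on [n] with T(ρ) = S if and only if there exist nonnegative reals α_t, one for each pointed triple t on [n], such that Σ_{s ∈ S} Δ_s = Σ_t α_t Δ_t and α_t > 0 for at least one pointed triple t ∉ S. -/
open SimpleGraph

/-- The standard basis vector `e_{x,y}` of the coordinate indexed by the unordered pair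
`{x,y}`. -/
def eVec {n : ℕ} (x y : Fin n) : Sym2 (Fin n) → ℝ :=
  fun e => if e = s(x, y) then 1 else 0

lemma eVec_comm {n : ℕ} (x y : Fin n) : eVec x y = eVec y x := by
  funext e
  unfold eVec
  rw [Sym2.eq_swap]

/-- `Δ` for the ordered triple `(a,b,c)`: `e_{a,c} + e_{c,b} - e_{a,b}`. -/
def DeltaO {n : ℕ} (a b c : Fin n) : Sym2 (Fin n) → ℝ :=
  eVec a c + eVec c b - eVec a b

lemma DeltaO_comm {n : ℕ} (a b c : Fin n) : DeltaO a b c = DeltaO b a c := by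
  unfold DeltaO
  rw [eVec_comm a c, eVec_comm c b, eVec_comm a b]
  abel

/-- `Δ` for the pair `e = {a,b}` pointed at `c`. -/
def DeltaS {n : ℕ} (e : Sym2 (Fin n)) (c : Fin n) : Sym2 (Fin n) → ℝ :=
  Sym2.lift ⟨fun a b => DeltaO a b c, fun a b => DeltaO_comm a b c⟩ e

/-- `Δ_t` for a pointed triple `t = {a,b;c}`: the vector `e_{a,c} + e_{c,b} - e_{a,b}`. -/
def Delta {n : ℕ} (t : PointedTriple n) : Sym2 (Fin n) → ℝ :=
  DeltaS t.val.1 t.val.2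

noncomputable instance (n : ℕ) : Fintype (PointedTriple n) := Fintype.ofFinite _

/-- A form of Motzkin's transposition theorem: either some continuous linear functional vanishes on
the vectors indexed by `S` and is positive on all others, or the sum of the vectors indexed by `S`
is a nonnegative combination of all vectors with a positive coefficient outside `S`. -/
lemma exists_functional_or_exists_combination {ι E : Type*} [Fintype ι] [AddCommGroup E]
    [Module ℝ E] [TopologicalSpace E] [IsTopologicalAddGroup E] [ContinuousSMul ℝ E]
    [LocallyConvexSpace ℝ E] [T2Space E] [FiniteDimensional ℝ E] (v : ι → E) (S : Finset ι) :
    (∃ f : E →L[ℝ] ℝ, (∀ s ∈ S, f (v s) = 0) ∧ ∀ t ∉ S, 0 < f (v t)) ∨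
      ∃ α : ι → ℝ, (∀ t, 0 ≤ α t) ∧ ∑ s ∈ S, v s = ∑ t, α t • v t ∧ ∃ t, t ∉ S ∧ 0 < α t := by
  classical
  set W : Submodule ℝ E := Submodule.span ℝ (v '' S)
  set P : Set (ι → ℝ) := stdSimplex ℝ ι ∩ {w | ∀ s ∈ S, w s = 0}
  set L : (ι → ℝ) →ₗ[ℝ] E := Fintype.linearCombination ℝ v with hL
  have hPcompact : IsCompact P := by
    refine (isCompact_stdSimplex ℝ ι).inter_right ?_
    simp only [Set.ofPred_forall]
    exact isClosed_iInter fun s => isClosed_iInter fun _ =>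
      isClosed_eq (continuous_apply s) continuous_const
  have hPconvex : Convex ℝ P := by
    refine (convex_stdSimplex ℝ ι).inter fun w hw z hz a b _ _ _ s hs => ?_
    simp [hw s hs, hz s hs]
  by_cases hdisj : Disjoint (L '' P) (W : Set E)
  · obtain ⟨f, u, u', hu, huu', hu'⟩ := geometric_hahn_banach_compact_closed
      (hPconvex.linear_image L) (hPcompact.image L.continuous_of_finiteDimensional)
      W.convex W.closed_of_finiteDimensional hdisj
    have hneg : u' < 0 := by simpa using hu' 0 W.zero_mem
    have hzero : ∀ x ∈ W, f x = 0 := by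
      intro x hx
      by_contra hne
      have h := hu' ((u' / f x) • x) (W.smul_mem _ hx)
      rw [map_smul, smul_eq_mul, div_mul_cancel₀ _ hne] at h
      exact lt_irrefl _ h
    refine Or.inl ⟨-f, fun s hs => ?_, fun t ht => ?_⟩
    · simp [hzero (v s) (Submodule.subset_span ⟨s, hs, rfl⟩)]
    · have h := hu (v t) ⟨Pi.single t 1, ⟨single_mem_stdSimplex ℝ t, fun s hs => ?_⟩, ?_⟩
      · have : f (v t) < 0 := by linarith
        simpa using this
      · exact Pi.single_eq_of_ne (by rintro rfl; exact ht hs) _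
      · simp [hL]
  · obtain ⟨_, ⟨w, ⟨⟨hw0, hw1⟩, hwS⟩, rfl⟩, hx⟩ := Set.not_disjoint_iff.1 hdisj
    obtain ⟨b', hb⟩ := (Submodule.mem_span_image_finset_iff_exists_fun ℝ).1 hx
    obtain ⟨b, rfl⟩ := Subtype.val_injective.surjective_comp_right b'
    simp only [Function.comp_apply, hL, Fintype.linearCombination_apply] at hb
    rw [Finset.sum_coe_sort S fun i => b i • v i] at hb
    have hsum : 0 ≤ ∑ i ∈ S, |b i| := Finset.sum_nonneg fun i _ => abs_nonneg _
    set c : ℝ := (1 + ∑ i ∈ S, |b i|)⁻¹ with hc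
    have hcpos : 0 < c := by positivity
    have hcb : ∀ s ∈ S, c * b s ≤ 1 := by
      intro s hs
      have h1 : |b s| ≤ ∑ i ∈ S, |b i| :=
        Finset.single_le_sum (fun i _ => abs_nonneg (b i)) hs
      rw [hc, inv_mul_le_iff₀ (by positivity)]
      linarith [le_abs_self (b s)]
    refine Or.inr ⟨fun i => (if i ∈ S then 1 - c * b i else 0) + c * w i, fun t => ?_, ?_, ?_⟩
    · refine add_nonneg ?_ (mul_nonneg hcpos.le (hw0 t))
      split_ifs with h
      · linarith [hcb t h]
      · exact le_rfl
    · simp only [add_smul, Finset.sum_add_distrib, ite_smul, zero_smul, Finset.sum_ite_mem,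
        Finset.univ_inter, sub_smul, Finset.sum_sub_distrib, one_smul, mul_smul,
        ← Finset.smul_sum, hb]
      abel
    · obtain ⟨t, -, ht⟩ : ∃ t ∈ Finset.univ, 0 < w t :=
        Finset.exists_lt_of_sum_lt (f := fun _ => 0) (by simp [hw1])
      have htS : t ∉ S := fun h => ht.ne' (hwS t h)
      exact ⟨t, htS, by simpa [htS] using mul_pos hcpos ht⟩

/-- The pointed triple `{a,b;c}`. -/
def PointedTriple.mk {n : ℕ} (a b c : Fin n) (hab : a ≠ b) (hca : c ≠ a) (hcb : c ≠ b) :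
    PointedTriple n :=
  ⟨(s(a, b), c), by simpa using hab, by simp [hca, hcb]⟩

lemma PointedTriple.exists_eq_mk {n : ℕ} (t : PointedTriple n) :
    ∃ a b c, ∃ (hab : a ≠ b) (hca : c ≠ a) (hcb : c ≠ b), t = .mk a b c hab hca hcb := by
  obtain ⟨⟨e, c⟩, he, hc⟩ := t
  induction e with
  | h a b =>
    simp only [Sym2.mem_iff, not_or] at hc
    exact ⟨a, b, c, by simpa using he, hc.1, hc.2, rfl⟩

lemma Delta_mk {n : ℕ} {a b c : Fin n} (hab : a ≠ b) (hca : c ≠ a) (hcb : c ≠ b) :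
    Delta (.mk a b c hab hca hcb) = eVec a c + eVec c b - eVec a b :=
  rfl

lemma mk_mem_Tpm_iff {n : ℕ} {ρ : Fin n → Fin n → ℝ} (hρ : ∀ x y, ρ x y = ρ y x) {a b c : Fin n}
    (hab : a ≠ b) (hca : c ≠ a) (hcb : c ≠ b) :
    PointedTriple.mk a b c hab hca hcb ∈ Tpm ρ ↔ ρ a b = ρ a c + ρ c b := by
  refine ⟨?_, fun h => ⟨a, b, rfl, h⟩⟩
  rintro ⟨x, y, hxy, h⟩
  change s(a, b) = s(x, y) at hxy
  change ρ x y = ρ x c + ρ c y at h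
  obtain ⟨rfl, rfl⟩ | ⟨rfl, rfl⟩ := Sym2.eq_iff.1 hxy
  · exact h
  · rw [hρ a b, hρ a c, hρ c b, h, add_comm]

/-- The linear functional on `Sym2 (Fin n) → ℝ` with coefficients `ρ`. -/
noncomputable def pairing {n : ℕ} (ρ : Fin n → Fin n → ℝ) (hρ : ∀ x y, ρ x y = ρ y x) :
    (Sym2 (Fin n) → ℝ) →ₗ[ℝ] ℝ :=
  Fintype.linearCombination ℝ (Sym2.lift ⟨ρ, hρ⟩)

lemma pairing_eVec {n : ℕ} (ρ : Fin n → Fin n → ℝ) (hρ : ∀ x y, ρ x y = ρ y x) (x y : Fin n) :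
    pairing ρ hρ (eVec x y) = ρ x y := by
  simp [pairing, Fintype.linearCombination_apply, eVec]

lemma IsPseudometric.pairing_Delta_nonneg {n : ℕ} {ρ : Fin n → Fin n → ℝ} (hρ : IsPseudometric ρ)
    (t : PointedTriple n) : 0 ≤ pairing ρ hρ.2.1 (Delta t) := by
  obtain ⟨a, b, c, hab, hca, hcb, rfl⟩ := t.exists_eq_mk
  simp only [Delta_mk, map_sub, map_add, pairing_eVec]
  linarith [hρ.2.2 a c b]

lemma mem_Tpm_iff_pairing_Delta {n : ℕ} {ρ : Fin n → Fin n → ℝ} (hρ : ∀ x y, ρ x y = ρ y x)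
    (t : PointedTriple n) : t ∈ Tpm ρ ↔ pairing ρ hρ (Delta t) = 0 := by
  obtain ⟨a, b, c, hab, hca, hcb, rfl⟩ := t.exists_eq_mk
  simp only [mk_mem_Tpm_iff hρ, Delta_mk, map_sub, map_add, pairing_eVec, sub_eq_zero]
  exact eq_comm

lemma PointedTriple.isEmpty_of_le_two {n : ℕ} (hn : n ≤ 2) : IsEmpty (PointedTriple n) := by
  refine ⟨fun t => ?_⟩
  obtain ⟨a, b, c, hab, hca, hcb, -⟩ := t.exists_eq_mk
  omega

/-- A functional that is nonnegative on all `Δ_t` comes from a pseudometric. -/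
lemma exists_pseudometric_of_functional {n : ℕ} (f : (Sym2 (Fin n) → ℝ) →ₗ[ℝ] ℝ)
    (hf : ∀ t : PointedTriple n, 0 ≤ f (Delta t)) :
    ∃ ρ : Fin n → Fin n → ℝ, IsPseudometric ρ ∧ ∀ t, t ∈ Tpm ρ ↔ f (Delta t) = 0 := by
  rcases le_or_gt n 2 with hn | hn
  · have := PointedTriple.isEmpty_of_le_two hn
    exact ⟨fun _ _ => 0, ⟨fun _ => rfl, fun _ _ => rfl, fun _ _ _ => by simp⟩, isEmptyElim⟩
  have htri : ∀ a b c, a ≠ b → c ≠ a → c ≠ b → f (eVec a b) ≤ f (eVec a c) + f (eVec c b) := by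
    intro a b c hab hca hcb
    have := hf (.mk a b c hab hca hcb)
    rw [Delta_mk, map_sub, map_add] at this
    linarith
  have hnonneg : ∀ a b, a ≠ b → 0 ≤ f (eVec a b) := by
    intro a b hab
    obtain ⟨c, hca, hcb⟩ := Fin.exists_ne_and_ne_of_two_lt a b hn
    have h₁ := htri a c b hca.symm hab.symm hcb.symm
    have h₂ := htri c b a hcb hca.symm hab
    rw [eVec_comm b c] at h₁
    rw [eVec_comm c a] at h₂
    linarith
  set ρ : Fin n → Fin n → ℝ := fun x y => if x = y then 0 else f (eVec x y) with hρ
  have hsymm : ∀ x y, ρ x y = ρ y x := fun x y => by simp only [hρ, eq_comm, eVec_comm x y]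
  refine ⟨ρ, ⟨fun x => if_pos rfl, hsymm, fun x y z => ?_⟩, fun t => ?_⟩
  · rcases eq_or_ne x y with rfl | hxy
    · simp [hρ]
    rcases eq_or_ne y z with rfl | hyz
    · simp [hρ]
    rcases eq_or_ne x z with rfl | hxz
    · rw [hsymm y x]
      simpa [hρ, hxy] using hnonneg x y hxy
    · simpa [hρ, hxy, hyz, hxz] using htri x z y hxz hxy.symm hyz
  · obtain ⟨a, b, c, hab, hca, hcb, rfl⟩ := t.exists_eq_mk
    rw [mk_mem_Tpm_iff hsymm]
    simp only [Delta_mk, map_sub, map_add, sub_eq_zero, hρ, hab, hca.symm, hcb, if_false]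
    exact eq_comm

theorem no_pseudometric_iff_witness (n : ℕ) (S : Finset (PointedTriple n)) :
    (¬ ∃ ρ : Fin n → Fin n → ℝ, IsPseudometric ρ ∧ Tpm ρ = (↑S : Set (PointedTriple n)))
      ↔
    ∃ α : PointedTriple n → ℝ, (∀ t, 0 ≤ α t) ∧
      (∑ s ∈ S, Delta s) = (∑ t : PointedTriple n, α t • Delta t) ∧
      ∃ t : PointedTriple n, t ∉ S ∧ 0 < α t := by
  constructor
  · intro h
    refine (exists_functional_or_exists_combination Delta S).resolve_left ?_
    rintro ⟨f, hfS, hf⟩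
    obtain ⟨ρ, hρ, hT⟩ := exists_pseudometric_of_functional f.toLinearMap fun t => by
      by_cases ht : t ∈ S
      · exact (hfS t ht).ge
      · exact (hf t ht).le
    refine h ⟨ρ, hρ, Set.ext fun t => (hT t).trans ⟨fun h0 => ?_, fun ht => hfS t ht⟩⟩
    by_contra ht
    exact (hf t ht).ne' h0
  · rintro ⟨α, hα, hsum, t, htS, ht⟩ ⟨ρ, hρ, hT⟩
    have hmem : ∀ s, s ∈ S ↔ pairing ρ hρ.2.1 (Delta s) = 0 := fun s => by
      rw [← mem_Tpm_iff_pairing_Delta, hT, Finset.mem_coe]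
    have h := congrArg (pairing ρ hρ.2.1) hsum
    simp only [map_sum, map_smul, smul_eq_mul] at h
    rw [Finset.sum_eq_zero fun s hs => (hmem s).1 hs, eq_comm,
      Finset.sum_eq_zero_iff_of_nonneg fun s _ =>
        mul_nonneg (hα s) (hρ.pairing_Delta_nonneg s)] at h
    exact htS ((hmem t).2 ((mul_eq_zero.1 (h t (Finset.mem_univ t))).resolve_left ht.ne'))
end
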